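/- arXiv:2311.06514 — 6 statements merged into one kernel-verified Lean document; each statement's English description precedes it below -/
import Mathlib

section
/- Every set augmented finite automaton M = (Q, Σ × D, q0, F, H, δ) whose language L(M) is nonempty accepts some data word that has an accepting run ρ of length at most |Q|·(|H|+2) − 1 (the length of a run being the number of transitions taken, which equals the length of the word read). -/
/-- A condition tested by a SAFA transition: membership (`pos h` = `p(h)`)
or non-membership (`neg h` = `!p(h)`) of the current data value in set `h`. -/
inductive SafaCond (H : Type) : Type
  | pos (h : H)
  | neg (h : H)

/-- The set name a condition refers to. -/
def SafaCond.name {H : Type} : SafaCond H → H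
  | .pos h => h
  | .neg h => h

/-- An operation of a SAFA transition: do nothing (`−`) or insert the
current data value into set `h` (`ins(h)`). -/
inductive SafaOp (H : Type) : Type
  | noop
  | ins (h : H)

/-- Whether a condition holds for data value `d` given set contents `s`. -/
def SafaCond.holds {H D : Type} : SafaCond H → D → (H → Set D) → Prop
  | .pos h, d, s => d ∈ s h
  | .neg h, d, s => d ∉ s h

/-- The effect of an operation on the set contents, reading data value `d`. -/
def SafaOp.apply {H D : Type} : SafaOp H → D → (H → Set D) → (H → Set D)
  | .noop, _, s => s
  | .ins h, d, s => fun j => s j ∪ {x | j = h ∧ x = d}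

/-- A transition of a SAFA: source state, attribute, condition, operation, target state. -/
structure SafaTrans (Q A H : Type) : Type where
  src : Q
  attr : A
  cond : SafaCond H
  op : SafaOp H
  dst : Q

/-- A set augmented finite automaton over attributes `A` and data values `D`:
a finite set of states `Q` with initial state `q0` and final states `F`,
a finite collection `H` of set names, and a transition relation `δ`. -/
structure SAFA (A D : Type) : Type 1 where
  Q : Type
  fintypeQ : Fintype Q
  q0 : Q
  F : Set Q
  H : Type
  fintypeH : Fintype H
  δ : Set (SafaTrans Q A H)

attribute [instance] SAFA.fintypeQ SAFA.fintypeH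

namespace SAFA

variable {A D : Type}

/-- A configuration: a state together with the current contents of the sets. -/
abbrev Config (M : SAFA A D) : Type := M.Q × (M.H → Set D)

/-- The initial configuration: initial state, all sets empty. -/
def init (M : SAFA A D) : M.Config := (M.q0, fun _ => ∅)

/-- One step: from configuration `c`, taking transition `t` while reading letter `ad`,
reaching configuration `c'`. -/
def StepVia (M : SAFA A D) (c : M.Config) (t : SafaTrans M.Q A M.H)
    (ad : A × D) (c' : M.Config) : Prop :=
  t ∈ M.δ ∧ t.src = c.1 ∧ t.attr = ad.1 ∧ t.dst = c'.1 ∧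
    t.cond.holds ad.2 c.2 ∧ c'.2 = t.op.apply ad.2 c.2

/-- Execution of a sequence of transitions `T` reading the data word `w`,
from configuration `c` to configuration `c'`. -/
inductive ExecFrom (M : SAFA A D) :
    M.Config → List (SafaTrans M.Q A M.H) → List (A × D) → M.Config → Prop
  | nil (c : M.Config) : ExecFrom M c [] [] c
  | cons {c c' c'' : M.Config} {t : SafaTrans M.Q A M.H}
      {ts : List (SafaTrans M.Q A M.H)} {ad : A × D} {w : List (A × D)} :
      M.StepVia c t ad c' → ExecFrom M c' ts w c'' → ExecFrom M c (t :: ts) (ad :: w) c''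

/-- Acceptance: some run from the initial configuration consumes all of `w`
and ends in a final state. -/
def Accepts (M : SAFA A D) (w : List (A × D)) : Prop :=
  ∃ T c, M.ExecFrom M.init T w c ∧ c.1 ∈ M.F

/-- The data language accepted by `M`. -/
def Lang (M : SAFA A D) : Set (List (A × D)) := {w | M.Accepts w}

/-- A SAFA is deterministic if, for every state and attribute, all outgoing
transitions test membership in one and the same set, with at most one transition
per polarity of the condition. -/
def IsDeterministic (M : SAFA A D) : Prop :=
  ∀ t1 t2 : SafaTrans M.Q A M.H, t1 ∈ M.δ → t2 ∈ M.δ →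
    t1.src = t2.src → t1.attr = t2.attr →
    t1.cond.name = t2.cond.name ∧ (t1.cond = t2.cond → t1 = t2)

end SAFA

namespace SAFA

variable {A D : Type} {M : SAFA A D}

theorem ExecFrom.append {c c' c'' : M.Config} {T T' : List (SafaTrans M.Q A M.H)}
    {w w' : List (A × D)} (h : M.ExecFrom c T w c') (h' : M.ExecFrom c' T' w' c'') :
    M.ExecFrom c (T ++ T') (w ++ w') c'' := by
  induction h with
  | nil => exact h'
  | cons hs _ ih => exact .cons hs (ih h')

theorem StepVia.snd_le {c c' : M.Config} {t : SafaTrans M.Q A M.H} {ad : A × D}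
    (h : M.StepVia c t ad c') : c.2 ≤ c'.2 := by
  obtain ⟨-, -, -, -, -, h⟩ := h
  rw [h]
  cases t.op with
  | noop => exact le_rfl
  | ins k => exact fun _ => Set.subset_union_left

theorem _root_.SafaOp.finite_apply {H : Type} (op : SafaOp H) (d : D) {s : H → Set D}
    (hs : ∀ h, (s h).Finite) (h : H) : (op.apply d s h).Finite := by
  cases op with
  | noop => exact hs h
  | ins k => exact (hs h).union ((Set.finite_singleton d).subset fun _ hx => hx.2)

theorem _root_.SafaOp.nonempty_apply {H : Type} (op : SafaOp H) (d e : D) {s r : H → Set D}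
    (hsr : ∀ h, (s h).Nonempty → (r h).Nonempty) (h : H)
    (hne : (op.apply d s h).Nonempty) : (op.apply e r h).Nonempty := by
  cases op with
  | noop => exact hsr h hne
  | ins k =>
    obtain ⟨x, hx | hx⟩ := hne
    · exact (hsr h ⟨x, hx⟩).mono Set.subset_union_left
    · exact ⟨e, Or.inr ⟨hx.1, rfl⟩⟩

theorem _root_.SafaCond.exists_holds [Infinite D] {H : Type} {p : SafaCond H} {d : D}
    {s r : H → Set D} (hp : p.holds d s) (hr : ∀ h, (r h).Finite)
    (hsr : ∀ h, (s h).Nonempty → (r h).Nonempty) : ∃ e, p.holds e r := by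
  cases p with
  | pos h => exact hsr h ⟨d, hp⟩
  | neg h => exact (hr h).exists_notMem

theorem ExecFrom.finite {c c' : M.Config} {T : List (SafaTrans M.Q A M.H)}
    {w : List (A × D)} (h : M.ExecFrom c T w c') (hc : ∀ k, (c.2 k).Finite) :
    ∀ k, (c'.2 k).Finite := by
  induction h with
  | nil => exact hc
  | cons hs _ ih =>
    obtain ⟨-, -, -, -, -, hs⟩ := hs
    exact ih (hs ▸ SafaOp.finite_apply _ _ hc)

/-- A transition sequence executable from `c` is executable, on a suitable word, from every
configuration with the same state and finite sets, nonempty wherever those of `c` are. -/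
theorem ExecFrom.simulate [Infinite D] {c c' d : M.Config} {T : List (SafaTrans M.Q A M.H)}
    {w : List (A × D)} (h : M.ExecFrom c T w c') (hcd : c.1 = d.1)
    (hd : ∀ k, (d.2 k).Finite) (hne : ∀ k, (c.2 k).Nonempty → (d.2 k).Nonempty) :
    ∃ w' d', M.ExecFrom d T w' d' ∧ c'.1 = d'.1 := by
  induction h generalizing d with
  | nil => exact ⟨[], d, .nil d, hcd⟩
  | @cons c c₁ c₂ t ts ad w hs _ ih =>
    obtain ⟨ht, hsrc, -, hdst, hp, hop⟩ := hs
    obtain ⟨e, he⟩ := SafaCond.exists_holds hp hd hne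
    obtain ⟨w', d', hex, heq⟩ := @ih (t.dst, t.op.apply e d.2) hdst.symm
      (SafaOp.finite_apply _ _ hd) (hop ▸ SafaOp.nonempty_apply _ _ _ hne)
    exact ⟨(t.attr, e) :: w', d', .cons ⟨ht, hsrc.trans hcd, rfl, rfl, he, rfl⟩ hex, heq⟩

/-- The configurations visited by an execution, extended constantly past its end. -/
theorem ExecFrom.exists_configs {c c' : M.Config} {T : List (SafaTrans M.Q A M.H)}
    {w : List (A × D)} (h : M.ExecFrom c T w c') :
    ∃ f : ℕ → M.Config, f 0 = c ∧ Monotone (fun i => (f i).2) ∧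
      ∀ i, M.ExecFrom c (T.take i) (w.take i) (f i) ∧
        M.ExecFrom (f i) (T.drop i) (w.drop i) c' := by
  induction h with
  | nil c => exact ⟨fun _ => c, rfl, monotone_const, fun i => by simpa using ExecFrom.nil c⟩
  | @cons c c₁ c₂ t ts ad w hs hex ih =>
    obtain ⟨g, hg0, hmono, hg⟩ := ih
    refine ⟨fun i => Nat.casesOn i c g, rfl, monotone_nat_of_le_succ ?_, ?_⟩
    · rintro (_ | i)
      · change c.2 ≤ (g 0).2
        exact hg0 ▸ hs.snd_le
      · exact hmono i.le_succ
    · rintro (_ | i)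
      · exact ⟨.nil c, .cons hs hex⟩
      · exact ⟨.cons hs (hg i).1, (hg i).2⟩

/-- An execution visiting two configurations with the same state and the same number of nonempty
sets can be shortened. -/
theorem ExecFrom.exists_shorter [Infinite D] {c c' : M.Config}
    {T : List (SafaTrans M.Q A M.H)} {w : List (A × D)} (h : M.ExecFrom c T w c')
    (hc : ∀ k, (c.2 k).Finite)
    (hT : Fintype.card M.Q * (Fintype.card M.H + 1) ≤ T.length) :
    ∃ T' w' d, M.ExecFrom c T' w' d ∧ d.1 = c'.1 ∧ T'.length < T.length := by
  obtain ⟨f, -, hmono, hf⟩ := h.exists_configs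
  let N : ℕ → Set M.H := fun i => {k | ((f i).2 k).Nonempty}
  have hN : Monotone N := fun i j hij k hk => hk.mono (hmono hij k)
  let g : Fin (T.length + 1) → M.Q × Fin (Fintype.card M.H + 1) := fun i =>
    ((f i).1, ⟨(N i).ncard, Nat.lt_succ_of_le <| by
      simpa [Nat.card_eq_fintype_card] using Set.ncard_le_card (N i)⟩)
  obtain ⟨i, j, hij, hg⟩ : ∃ i j, i < j ∧ g i = g j := by
    obtain ⟨i, j, hne, hg⟩ := Fintype.exists_ne_map_eq_of_card_lt g (by simpa using by omega)
    rcases lt_or_gt_of_ne hne with hlt | hlt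
    · exact ⟨i, j, hlt, hg⟩
    · exact ⟨j, i, hlt, hg.symm⟩
  obtain ⟨hq, hcard⟩ := Prod.ext_iff.1 hg
  have hNeq : N i = N j :=
    Set.eq_of_subset_of_ncard_le (hN hij.le) (Fin.ext_iff.1 hcard).ge (Set.toFinite _)
  obtain ⟨w', d, hex, hd⟩ := (hf j).2.simulate hq.symm ((hf i).1.finite hc)
    fun k hk => (hNeq.ge hk : k ∈ N i)
  refine ⟨_, _, d, (hf i).1.append hex, hd.symm, ?_⟩
  have := j.is_lt
  have : (i : ℕ) < j := hij
  simp only [List.length_append, List.length_take, List.length_drop]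
  omega

end SAFA

/-- every SAFA with nonempty language accepts some data word with an
accepting run of length at most |Q|·(|H|+2) − 1 (run length = number of transitions
= length of the word read). -/
theorem safa_short_accepting_run {A D : Type} [Fintype A] [Countable D] [Infinite D]
    (M : SAFA A D) (hne : M.Lang ≠ ∅) :
    ∃ w ∈ M.Lang, ∃ (T : List (SafaTrans M.Q A M.H)) (c : M.Config),
      M.ExecFrom M.init T w c ∧ c.1 ∈ M.F ∧
      T.length ≤ Fintype.card M.Q * (Fintype.card M.H + 2) - 1 := by
  classical
  have hex : ∃ n T w c, M.ExecFrom M.init T w c ∧ c.1 ∈ M.F ∧ T.length = n := by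
    obtain ⟨w, T, c, h, hc⟩ := Set.nonempty_iff_ne_empty.2 hne
    exact ⟨_, T, w, c, h, hc, rfl⟩
  obtain ⟨T, w, c, h, hc, hlen⟩ := Nat.find_spec hex
  refine ⟨w, ⟨T, c, h, hc⟩, T, c, h, hc, ?_⟩
  by_contra! hlt
  have hle : Fintype.card M.Q * (Fintype.card M.H + 1) ≤ T.length := by
    have : 0 < Fintype.card M.Q := Fintype.card_pos_iff.2 ⟨M.q0⟩
    rw [Nat.mul_add] at hlt ⊢
    omega
  obtain ⟨T', w', d, h', hd, hlt'⟩ := h.exists_shorter (fun _ => Set.finite_empty) hle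
  exact Nat.find_min hex (hlen ▸ hlt') ⟨T', w', d, h', hd ▸ hc, rfl⟩
end

section
/- For every k ≥ 1, the class of data languages accepted by SAFA with exactly k set names is strictly contained in the class of data languages accepted by SAFA with exactly k+1 set names; that is, L_SAFA(|H|=k) ⊊ L_SAFA(|H|=k+1). -/
namespace SAFA

variable {A D : Type}

section Exec

variable {M : SAFA A D}

theorem execFrom_append_iff {c c' : M.Config} {T : List (SafaTrans M.Q A M.H)}
    {u v : List (A × D)} :
    M.ExecFrom c T (u ++ v) c' ↔
      ∃ T₁ T₂ d, T = T₁ ++ T₂ ∧ M.ExecFrom c T₁ u d ∧ M.ExecFrom d T₂ v c' := by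
  constructor
  · intro h
    induction u generalizing c T with
    | nil => exact ⟨[], T, c, rfl, .nil c, h⟩
    | cons ad u ih =>
      cases h with
      | cons hs he =>
        obtain ⟨T₁, T₂, d, rfl, h₁, h₂⟩ := ih he
        exact ⟨_ :: T₁, T₂, d, rfl, .cons hs h₁, h₂⟩
  · rintro ⟨T₁, T₂, d, rfl, h₁, h₂⟩
    induction h₁ with
    | nil => exact h₂
    | cons hs _ ih => exact .cons hs (ih h₂)

/-- Renaming of the data values in a configuration. -/
def Config.rename (σ : Equiv.Perm D) (c : M.Config) : M.Config :=
  (c.1, fun h => σ.symm ⁻¹' c.2 h)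

theorem StepVia.rename (σ : Equiv.Perm D) {c c' : M.Config} {t : SafaTrans M.Q A M.H}
    {ad : A × D} (h : M.StepVia c t ad c') :
    M.StepVia (Config.rename σ c) t (ad.1, σ ad.2) (Config.rename σ c') := by
  obtain ⟨h₁, h₂, h₃, h₄, h₅, h₆⟩ := h
  refine ⟨h₁, h₂, h₃, h₄, ?_, ?_⟩
  · cases hc : t.cond <;> simpa [hc, SafaCond.holds, Config.rename] using h₅
  · cases ho : t.op with
    | noop => simp [Config.rename, h₆, ho, SafaOp.apply]
    | ins j =>
      funext i
      ext x
      simp [Config.rename, h₆, ho, SafaOp.apply, Equiv.symm_apply_eq]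

theorem ExecFrom.rename (σ : Equiv.Perm D) {c c' : M.Config} {T : List (SafaTrans M.Q A M.H)}
    {w : List (A × D)} (h : M.ExecFrom c T w c') :
    M.ExecFrom (Config.rename σ c) T (w.map fun ad => (ad.1, σ ad.2)) (Config.rename σ c') := by
  induction h with
  | nil => exact .nil _
  | cons hs _ ih => exact .cons (hs.rename σ) ih

theorem Config.rename_swap_eq_self [DecidableEq D] {c : M.Config} {x y : D}
    (h : ∀ i, x ∈ c.2 i ↔ y ∈ c.2 i) : Config.rename (Equiv.swap x y) c = c := by
  refine Prod.ext rfl ?_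
  funext i
  ext z
  simp only [Config.rename, Equiv.symm_swap, Set.mem_preimage, Equiv.swap_apply_def]
  split_ifs with h₁ h₂
  · rw [h₁, h i]
  · rw [h₂, h i]
  · rfl

/-- After reading pairwise distinct fresh data values, every value lies in at most one set. -/
theorem ExecFrom.eq_of_mem_of_mem {c c' : M.Config} {T : List (SafaTrans M.Q A M.H)}
    {w : List (A × D)} (h : M.ExecFrom c T w c') (hw : (w.map Prod.snd).Nodup)
    (hfresh : ∀ d ∈ w.map Prod.snd, ∀ i, d ∉ c.2 i)
    (hc : ∀ d i j, d ∈ c.2 i → d ∈ c.2 j → i = j) :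
    ∀ d i j, d ∈ c'.2 i → d ∈ c'.2 j → i = j := by
  induction h with
  | nil => exact hc
  | @cons c c₁ c₂ t ts ad w hs _ ih =>
    obtain ⟨-, -, -, -, -, h₆⟩ := hs
    simp only [List.map_cons, List.nodup_cons] at hw
    simp only [List.map_cons, List.mem_cons, forall_eq_or_imp] at hfresh
    cases ho : t.op with
    | noop =>
      rw [ho] at h₆
      refine ih hw.2 ?_ ?_ <;> rw [h₆]
      · exact hfresh.2
      · exact hc
    | ins l =>
      rw [ho] at h₆
      refine ih hw.2 ?_ ?_ <;> rw [h₆]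
      · rintro d hd i (hi | ⟨-, rfl⟩)
        · exact hfresh.2 d hd i hi
        · exact hw.1 hd
      · rintro d i j (hi | ⟨rfl, rfl⟩) (hj | ⟨rfl, hd⟩)
        · exact hc d i j hi hj
        · exact absurd (hd ▸ hi) (hfresh.1 i)
        · exact absurd hj (hfresh.1 j)
        · rfl

end Exec

section AddSet

/-- The automaton with one additional, unused set name. -/
def addSet (M : SAFA A D) : SAFA A D where
  Q := M.Q
  fintypeQ := M.fintypeQ
  q0 := M.q0
  F := M.F
  H := Option M.H
  fintypeH := inferInstance
  δ := {t | ∃ t₀ ∈ M.δ, t = ⟨t₀.src, t₀.attr,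
    match t₀.cond with
      | .pos h => .pos (some h)
      | .neg h => .neg (some h),
    match t₀.op with
      | .noop => .noop
      | .ins h => .ins (some h), t₀.dst⟩}

/-- A configuration of `M` seen as a configuration of `M.addSet` whose additional set is empty. -/
def liftConfig (M : SAFA A D) (c : M.Config) : M.addSet.Config :=
  (c.1, fun o : Option M.H => o.elim ∅ c.2)

variable {M : SAFA A D}

theorem liftConfig_apply (c : M.Config) (q : M.Q) (op : SafaOp M.H) (d : D) :
    M.liftConfig (q, op.apply d c.2) =
      (q, SafaOp.apply (match op with
        | .noop => .noop
        | .ins h => .ins (some h)) d (M.liftConfig c).2) := by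
  refine Prod.ext rfl ?_
  cases op with
  | noop => rfl
  | ins h =>
    funext o
    ext x
    cases o with
    | none => simp [liftConfig, SafaOp.apply]
    | some j => simp [liftConfig, SafaOp.apply]

theorem liftConfig_init : M.liftConfig M.init = M.addSet.init := by
  refine Prod.ext rfl ?_
  funext o
  cases o <;> rfl

theorem StepVia.lift {c c' : M.Config} {t : SafaTrans M.Q A M.H} {ad : A × D}
    (h : M.StepVia c t ad c') :
    ∃ t', M.addSet.StepVia (M.liftConfig c) t' ad (M.liftConfig c') := by
  obtain ⟨q', s'⟩ := c'
  obtain ⟨h₁, h₂, h₃, rfl, h₅, rfl⟩ := h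
  refine ⟨_, ⟨t, h₁, rfl⟩, h₂, h₃, rfl, ?_, ?_⟩
  · cases hc : t.cond <;> rw [hc] at h₅ <;> exact h₅
  · rw [liftConfig_apply]; rfl

theorem StepVia.unlift {c : M.Config} {c' : M.addSet.Config}
    {t : SafaTrans M.addSet.Q A M.addSet.H} {ad : A × D}
    (h : M.addSet.StepVia (M.liftConfig c) t ad c') :
    ∃ t₀ c₀, c' = M.liftConfig c₀ ∧ M.StepVia c t₀ ad c₀ := by
  obtain ⟨q', s'⟩ := c'
  obtain ⟨⟨t₀, h₁, rfl⟩, h₂, h₃, rfl, h₅, rfl⟩ := h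
  refine ⟨t₀, (t₀.dst, t₀.op.apply ad.2 c.2), ?_, h₁, h₂, h₃, rfl, ?_, rfl⟩
  · rw [liftConfig_apply]; rfl
  · cases hc : t₀.cond <;> simp only [hc] at h₅ <;> exact h₅

theorem lang_addSet (M : SAFA A D) : M.addSet.Lang = M.Lang := by
  ext w
  constructor
  · rintro ⟨T, c, h, hF⟩
    have key : ∀ (w : List (A × D)) (T) (c₀ : M.Config) (c : M.addSet.Config),
        M.addSet.ExecFrom (M.liftConfig c₀) T w c →
        ∃ T' c', c = M.liftConfig c' ∧ M.ExecFrom c₀ T' w c' := by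
      intro w
      induction w with
      | nil =>
        intro T c₀ c h
        cases h
        exact ⟨[], c₀, rfl, .nil _⟩
      | cons ad w ih =>
        intro T c₀ c h
        cases h with
        | cons hs he =>
          obtain ⟨t₀, c₁, rfl, hs'⟩ := hs.unlift
          obtain ⟨T', c', rfl, he'⟩ := ih _ _ _ he
          exact ⟨_, c', rfl, .cons hs' he'⟩
    rw [← liftConfig_init] at h
    obtain ⟨T', c', rfl, h'⟩ := key _ _ _ _ h
    exact ⟨T', c', h', hF⟩
  · rintro ⟨T, c, h, hF⟩
    have key : ∀ {c c' : M.Config} {T w}, M.ExecFrom c T w c' →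
        ∃ T', M.addSet.ExecFrom (M.liftConfig c) T' w (M.liftConfig c') := by
      intro c c' T w h
      induction h with
      | nil => exact ⟨[], .nil _⟩
      | cons hs _ ih =>
        obtain ⟨T', h'⟩ := ih
        obtain ⟨t', hs'⟩ := hs.lift
        exact ⟨t' :: T', .cons hs' h'⟩
    obtain ⟨T', h'⟩ := key h
    exact ⟨T', M.liftConfig c, liftConfig_init ▸ h', hF⟩

end AddSet

section Recall

/-- The automaton over the letters `(i, false)` ("store in set `i`") and `(i, true)`
("recall from set `i`"), accepting the words in which every recalled value has been stored
in the same set before. -/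
def storeRecall (ι D : Type) [Fintype ι] : SAFA (ι × Bool) D where
  Q := Unit
  fintypeQ := inferInstance
  q0 := ()
  F := Set.univ
  H := ι
  fintypeH := inferInstance
  δ := {t | (∃ i, t.attr = (i, false) ∧ t.op = .ins i) ∨
    ∃ i, t.attr = (i, true) ∧ t.cond = .pos i ∧ t.op = .noop}

variable {ι : Type} [Fintype ι]

theorem storeRecall_mem_of_execFrom {c c' : (storeRecall ι D).Config}
    {T : List (SafaTrans (storeRecall ι D).Q (ι × Bool) (storeRecall ι D).H)} {w : List ((ι × Bool) × D)}
    (h : (storeRecall ι D).ExecFrom c T w c') {i : ι} {d : D} (hd : ((i, true), d) ∈ w) :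
    d ∈ c.2 i ∨ ((i, false), d) ∈ w := by
  induction h with
  | nil => simp at hd
  | @cons c c₁ c₂ t ts ad w hs _ ih =>
    obtain ⟨a, e⟩ := ad
    obtain ⟨hδ, -, h₃, -, h₅, h₆⟩ := hs
    rcases hδ with ⟨j, hj, ho⟩ | ⟨j, hj, hc, ho⟩
    · rw [hj] at h₃
      subst h₃
      simp only [List.mem_cons, Prod.mk.injEq, Bool.true_eq_false, and_false, false_and,
        false_or] at hd
      rcases ih hd with h | h
      · rw [h₆, ho] at h
        rcases h with h | ⟨rfl, rfl⟩
        · exact .inl h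
        · exact .inr (List.mem_cons_self ..)
      · exact .inr (List.mem_cons_of_mem _ h)
    · rw [hj] at h₃
      subst h₃
      rcases List.mem_cons.1 hd with h | h
      · obtain ⟨⟨rfl, -⟩, rfl⟩ := by simpa using h
        rw [hc] at h₅
        exact .inl h₅
      · rcases ih h with h | h
        · rw [h₆, ho] at h
          exact .inl h
        · exact .inr (List.mem_cons_of_mem _ h)

theorem storeRecall_exists_execFrom_store (x : ι → D) (l : List ι) (c : (storeRecall ι D).Config) :
    ∃ T c', (storeRecall ι D).ExecFrom c T (l.map fun i => ((i, false), x i)) c' ∧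
      (∀ i, c.2 i ⊆ c'.2 i) ∧ ∀ i ∈ l, x i ∈ c'.2 i := by
  induction l generalizing c with
  | nil => exact ⟨[], c, .nil _, fun _ => subset_rfl, by simp⟩
  | cons i l ih =>
    obtain ⟨T, c', h, hsub, hl⟩ := ih ((), SafaOp.apply (.ins i) (x i) c.2)
    have hcond : ∃ b : SafaCond ι, b.holds (x i) c.2 := by
      by_cases hx : x i ∈ c.2 i
      · exact ⟨.pos i, hx⟩
      · exact ⟨.neg i, hx⟩
    obtain ⟨b, hb⟩ := hcond
    refine ⟨⟨(), (i, false), b, .ins i, ()⟩ :: T, c',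
      .cons ⟨.inl ⟨i, rfl, rfl⟩, rfl, rfl, rfl, hb, rfl⟩ h,
      fun j => Set.subset_union_left.trans (hsub j), ?_⟩
    intro j hj
    rcases List.mem_cons.1 hj with rfl | hj
    · exact hsub j (.inr ⟨rfl, rfl⟩)
    · exact hl j hj

theorem storeRecall_exists_execFrom_recall (x : ι → D) (l : List ι) (c : (storeRecall ι D).Config)
    (hc : ∀ i, x i ∈ c.2 i) :
    ∃ T, (storeRecall ι D).ExecFrom c T (l.map fun i => ((i, true), x i)) c := by
  induction l with
  | nil => exact ⟨[], .nil _⟩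
  | cons i l ih =>
    obtain ⟨T, h⟩ := ih
    exact ⟨⟨(), (i, true), .pos i, .noop, ()⟩ :: T,
      .cons ⟨.inr ⟨i, rfl, rfl, rfl⟩, rfl, rfl, rfl, hc i, rfl⟩ h⟩

/-- No automaton with fewer set names than `ι` has elements accepts the language of
`storeRecall ι D`. -/
theorem lang_ne_lang_storeRecall [Infinite D] (M : SAFA (ι × Bool) D)
    (hM : Fintype.card M.H < Fintype.card ι) : M.Lang ≠ (storeRecall ι D).Lang := by
  classical
  intro hL
  let x : Option ι ↪ D :=
    (Fintype.equivFin (Option ι)).toEmbedding.trans (Fin.valEmbedding.trans (Infinite.natEmbedding D))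
  let l : List ι := Finset.univ.toList
  let y : ι → D := fun i => x (some i)
  have hy : Function.Injective y := x.injective.comp (Option.some_injective ι)
  have hmem : (l.map fun i => ((i, false), y i)) ++ (l.map fun i => ((i, true), y i)) ∈
      M.Lang := by
    rw [hL]
    obtain ⟨T₁, c, h₁, -, hc⟩ := storeRecall_exists_execFrom_store y l (storeRecall ι D).init
    obtain ⟨T₂, h₂⟩ := storeRecall_exists_execFrom_recall y l c fun i => hc i (Finset.mem_toList.2 (Finset.mem_univ _))
    exact ⟨_, c, execFrom_append_iff.2 ⟨T₁, T₂, c, rfl, h₁, h₂⟩, trivial⟩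
  obtain ⟨T, c', h, hF⟩ := hmem
  obtain ⟨T₁, T₂, c, rfl, h₁, h₂⟩ := execFrom_append_iff.1 h
  have huniq := h₁.eq_of_mem_of_mem
    (by simpa [Function.comp_def] using (Finset.nodup_toList _).map hy)
    (fun _ _ _ h => h) (fun _ _ _ h _ => h.elim)
  -- By pigeonhole, two of the `card ι + 1` values lie in exactly the same sets.
  let f : Option ι → Option M.H := fun o =>
    if h : ∃ i, x o ∈ c.2 i then some h.choose else none
  have hf : ∀ o i, x o ∈ c.2 i ↔ f o = some i := by
    intro o i
    simp only [f]
    split_ifs with h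
    · rw [Option.some_inj]
      exact ⟨fun hi => huniq _ _ _ h.choose_spec hi, fun hi => hi ▸ h.choose_spec⟩
    · simpa using fun hi => h ⟨i, hi⟩
  obtain ⟨o, o', hne, hoo⟩ := Fintype.exists_ne_map_eq_of_card_lt f (by simpa using hM)
  obtain ⟨i, p, hip, hp⟩ : ∃ i p, some i ≠ p ∧ f (some i) = f p := by
    cases o with
    | some i => exact ⟨i, o', hne, hoo⟩
    | none =>
      cases o' with
      | some i => exact ⟨i, none, hne.symm, hoo.symm⟩
      | none => exact absurd rfl hne
  have h₃ := h₂.rename (Equiv.swap (x (some i)) (x p))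
  rw [Config.rename_swap_eq_self fun j => by rw [hf, hf, hp]] at h₃
  have hmem' : _ ∈ M.Lang := ⟨_, _, execFrom_append_iff.2 ⟨T₁, T₂, c, rfl, h₁, h₃⟩, hF⟩
  rw [hL] at hmem'
  obtain ⟨T', c'', h', -⟩ := hmem'
  rcases storeRecall_mem_of_execFrom h' (i := i) (d := x p) (by simp [l, y]) with h | h
  · exact h
  · exact hip (by simpa [l, y] using h)

end Recall

end SAFA

/-- for every k ≥ 1, the class of data languages accepted by SAFA with
exactly k set names is strictly contained in the class accepted by SAFA with exactly
k+1 set names (containment over every finite alphabet, strictness witnessed over some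
finite alphabet). -/
theorem safa_set_hierarchy {D : Type} [Countable D] [Infinite D] (k : ℕ) (hk : 1 ≤ k) :
    (∀ (A : Type) (_ : Fintype A) (L : Set (List (A × D))),
        (∃ M : SAFA A D, Fintype.card M.H = k ∧ M.Lang = L) →
        ∃ M : SAFA A D, Fintype.card M.H = k + 1 ∧ M.Lang = L) ∧
    ∃ (A : Type) (_ : Fintype A) (L : Set (List (A × D))),
      (∃ M : SAFA A D, Fintype.card M.H = k + 1 ∧ M.Lang = L) ∧
      ¬ ∃ M : SAFA A D, Fintype.card M.H = k ∧ M.Lang = L := by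
  refine ⟨?_, Fin (k + 1) × Bool, inferInstance, (SAFA.storeRecall (Fin (k + 1)) D).Lang,
    ⟨_, Fintype.card_fin (k + 1), rfl⟩, ?_⟩
  · rintro A _ L ⟨M, hM, rfl⟩
    exact ⟨M.addSet, (Fintype.card_option (α := M.H)).trans (by rw [hM]), M.lang_addSet⟩
  · rintro ⟨M, hM, hL⟩
    exact M.lang_ne_lang_storeRecall (by simp [hM]) hL
end

section
/- The class of data languages accepted by SAFA is not closed under intersection. Specifically, over Σ = {a, b}: the language L_fd(a) (all data words in which the data values occurring with attribute a are pairwise distinct) is accepted by a SAFA, and the language L_a∃b (all data words in which every occurrence of a data value with attribute a is preceded at an earlier position by an occurrence of the same data value with attribute b) is accepted by a SAFA, but no SAFA accepts L_fd(a) ∩ L_a∃b. -/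
/-- L_fd(a) over Σ = Fin 2 (with a = 0, b = 1): the data values occurring with
attribute a are pairwise distinct. -/
def Lfd (D : Type) : Set (List (Fin 2 × D)) :=
  {w | ((w.filter fun p => p.1 = (0 : Fin 2)).map Prod.snd).Nodup}

/-- L_a∃b over Σ = Fin 2 (a = 0, b = 1): every occurrence of a data value with
attribute a is preceded at an earlier position by the same data value with attribute b. -/
def LaExistsB (D : Type) : Set (List (Fin 2 × D)) :=
  {w | ∀ i : Fin w.length, (w.get i).1 = 0 →
        ∃ j : Fin w.length, (j : ℕ) < (i : ℕ) ∧ w.get j = (1, (w.get i).2)}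

namespace SAFA

variable {A D : Type}

/-- Acceptance of a data word starting from an arbitrary configuration. -/
def AcceptsFrom (M : SAFA A D) (c : M.Config) (w : List (A × D)) : Prop :=
  ∃ T c', M.ExecFrom c T w c' ∧ c'.1 ∈ M.F

theorem acceptsFrom_nil {M : SAFA A D} {c : M.Config} : M.AcceptsFrom c [] ↔ c.1 ∈ M.F := by
  constructor
  · rintro ⟨T, c', h, hF⟩
    cases h
    exact hF
  · exact fun h => ⟨[], c, .nil c, h⟩

theorem acceptsFrom_cons {M : SAFA A D} {c : M.Config} {p : A × D} {w : List (A × D)} :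
    M.AcceptsFrom c (p :: w) ↔ ∃ t ∈ M.δ, t.src = c.1 ∧ t.attr = p.1 ∧
      t.cond.holds p.2 c.2 ∧ M.AcceptsFrom (t.dst, t.op.apply p.2 c.2) w := by
  constructor
  · rintro ⟨T, c', h, hF⟩
    cases h with
    | @cons _ c₁ _ t ts _ _ hs he =>
      obtain ⟨ht, hsrc, hattr, hdst, hcond, hset⟩ := hs
      obtain rfl : c₁ = (t.dst, t.op.apply p.2 c.2) := Prod.ext hdst.symm hset
      exact ⟨t, ht, hsrc, hattr, hcond, ts, c', he, hF⟩
  · rintro ⟨t, ht, hsrc, hattr, hcond, T, c', he, hF⟩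
    exact ⟨t :: T, c', .cons ⟨ht, hsrc, hattr, rfl, hcond, rfl⟩ he, hF⟩

theorem acceptsFrom_append {M : SAFA A D} {c : M.Config} {u v : List (A × D)} :
    M.AcceptsFrom c (u ++ v) ↔ ∃ T c', M.ExecFrom c T u c' ∧ M.AcceptsFrom c' v := by
  induction u generalizing c with
  | nil =>
    constructor
    · exact fun h => ⟨[], c, .nil c, h⟩
    · rintro ⟨T, c', h, hv⟩
      cases h
      exact hv
  | cons p u ih =>
    rw [List.cons_append, acceptsFrom_cons]
    constructor
    · rintro ⟨t, ht, hsrc, hattr, hcond, h⟩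
      obtain ⟨T, c', he, hv⟩ := ih.1 h
      exact ⟨t :: T, c', .cons ⟨ht, hsrc, hattr, rfl, hcond, rfl⟩ he, hv⟩
    · rintro ⟨T, c', h, hv⟩
      cases h with
      | @cons _ c₁ _ t ts _ _ hs he =>
        obtain ⟨ht, hsrc, hattr, hdst, hcond, hset⟩ := hs
        obtain rfl : c₁ = (t.dst, t.op.apply p.2 c.2) := Prod.ext hdst.symm hset
        exact ⟨t, ht, hsrc, hattr, hcond, ih.2 ⟨ts, c', he, hv⟩⟩

end SAFA

theorem SafaOp.mem_apply_iff_of_ne {H D : Type} (o : SafaOp H) {x d : D} (hx : x ≠ d)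
    (s : H → Set D) (h : H) : x ∈ o.apply d s h ↔ x ∈ s h := by
  cases o <;> simp [SafaOp.apply, hx]

theorem SafaOp.subset_apply {H D : Type} (o : SafaOp H) (d : D) (s : H → Set D) (h : H) :
    s h ⊆ o.apply d s h := by
  cases o <;> simp [SafaOp.apply]

theorem SafaOp.mem_apply_congr {H D : Type} (o : SafaOp H) {x d : D} {s s' : H → Set D}
    (hx : ∀ h, x ∈ s h ↔ x ∈ s' h) (h : H) : x ∈ o.apply d s h ↔ x ∈ o.apply d s' h := by
  cases o <;> simp [SafaOp.apply, hx]

theorem SafaCond.holds_congr {H D : Type} (k : SafaCond H) {d : D} {s s' : H → Set D}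
    (hd : ∀ h, d ∈ s h ↔ d ∈ s' h) : k.holds d s ↔ k.holds d s' := by
  cases k <;> simp [SafaCond.holds, hd]

namespace SAFA

variable {A D : Type}

/-- Acceptance depends only on the set membership of the data values still to be read. -/
theorem AcceptsFrom.congr_sets {M : SAFA A D} {q : M.Q} {s s' : M.H → Set D}
    {w : List (A × D)} (hs : ∀ p ∈ w, ∀ h, p.2 ∈ s h ↔ p.2 ∈ s' h)
    (hw : M.AcceptsFrom (q, s) w) : M.AcceptsFrom (q, s') w := by
  induction w generalizing q s s' with
  | nil => exact acceptsFrom_nil.2 ((acceptsFrom_nil (c := (q, s))).1 hw)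
  | cons p w ih =>
    obtain ⟨t, ht, hsrc, hattr, hcond, h⟩ := acceptsFrom_cons.1 hw
    refine acceptsFrom_cons.2 ⟨t, ht, hsrc, hattr,
      (t.cond.holds_congr (hs p List.mem_cons_self)).1 hcond, ih ?_ h⟩
    exact fun r hr => t.op.mem_apply_congr (hs r (List.mem_cons_of_mem _ hr))

theorem ExecFrom.mem_iff_of_notMem {M : SAFA A D} {c c' : M.Config}
    {T : List (SafaTrans M.Q A M.H)} {w : List (A × D)} (he : M.ExecFrom c T w c') {x : D}
    (hx : x ∉ w.map Prod.snd) (h : M.H) : x ∈ c'.2 h ↔ x ∈ c.2 h := by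
  induction he with
  | nil => rfl
  | cons hs _ ih =>
    obtain ⟨-, -, -, -, -, hset⟩ := hs
    simp only [List.map_cons, List.mem_cons, not_or] at hx
    rw [ih hx.2, hset, SafaOp.mem_apply_iff_of_ne _ hx.1]

theorem ExecFrom.subset_sets {M : SAFA A D} {c c' : M.Config}
    {T : List (SafaTrans M.Q A M.H)} {w : List (A × D)} (he : M.ExecFrom c T w c') (h : M.H) :
    c.2 h ⊆ c'.2 h := by
  induction he with
  | nil => exact subset_rfl
  | cons hs _ ih =>
    obtain ⟨-, -, -, -, -, hset⟩ := hs
    exact (SafaOp.subset_apply _ _ _ _).trans (hset ▸ ih)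

/-- If replacing the data value `d` of one letter, not read later, by a value `e` that is in no
set always leads to rejection, then the letter was read by testing membership in some set `h`;
the set already contains `d` at the start if `d` was not read before, and `d` can be replaced
by any initial member of `h` that is not read later. -/
theorem AcceptsFrom.exists_replaceable {M : SAFA A D} {c : M.Config} {u v : List (A × D)}
    {a : A} {d e : D} (hw : M.AcceptsFrom c (u ++ (a, d) :: v))
    (hdu : d ∉ u.map Prod.snd) (hdv : d ∉ v.map Prod.snd)
    (hec : ∀ h, e ∉ c.2 h) (heu : e ∉ u.map Prod.snd) (hev : e ∉ v.map Prod.snd)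
    (hrej : ¬ M.AcceptsFrom c (u ++ (a, e) :: v)) :
    ∃ h, d ∈ c.2 h ∧ ∀ x ∈ c.2 h, x ∉ v.map Prod.snd → M.AcceptsFrom c (u ++ (a, x) :: v) := by
  obtain ⟨T, c₁, he, hv⟩ := acceptsFrom_append.1 hw
  obtain ⟨t, ht, hsrc, hattr, hcond, hacc⟩ := acceptsFrom_cons.1 hv
  have key : ∀ x, x ∉ v.map Prod.snd → t.cond.holds x c₁.2 →
      M.AcceptsFrom c (u ++ (a, x) :: v) := fun x hxv hx => by
    refine acceptsFrom_append.2 ⟨T, c₁, he, acceptsFrom_cons.2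
      ⟨t, ht, hsrc, hattr, hx, hacc.congr_sets fun p hp h => ?_⟩⟩
    have hp' : p.2 ∈ v.map Prod.snd := List.mem_map_of_mem hp
    have hpd : p.2 ≠ d := fun h => hdv (h ▸ hp')
    have hpx : p.2 ≠ x := fun h => hxv (h ▸ hp')
    rw [SafaOp.mem_apply_iff_of_ne _ hpd, SafaOp.mem_apply_iff_of_ne _ hpx]
  cases hk : t.cond with
  | pos h =>
    rw [hk] at hcond key
    exact ⟨h, (he.mem_iff_of_notMem hdu h).1 hcond,
      fun x hx hxv => key x hxv (he.subset_sets h hx)⟩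
  | neg h =>
    rw [hk] at key
    exact absurd (key e hev fun hm => hec h ((he.mem_iff_of_notMem heu h).1 hm)) hrej

/-- One set collects the data values read with attribute `0`, none of which may repeat. -/
abbrev distinctZero (D : Type) : SAFA (Fin 2) D where
  Q := Unit
  fintypeQ := inferInstance
  q0 := ()
  F := Set.univ
  H := Unit
  fintypeH := inferInstance
  δ := {t | (t.attr = 0 ∧ t.cond = .neg () ∧ t.op = .ins ()) ∨ (t.attr = 1 ∧ t.op = .noop)}

/-- One set collects the data values read with attribute `1`; those read with attribute `0`
must belong to it. -/
abbrev zeroAfterOne (D : Type) : SAFA (Fin 2) D where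
  Q := Unit
  fintypeQ := inferInstance
  q0 := ()
  F := Set.univ
  H := Unit
  fintypeH := inferInstance
  δ := {t | (t.attr = 0 ∧ t.cond = .pos () ∧ t.op = .noop) ∨ (t.attr = 1 ∧ t.op = .ins ())}

theorem distinctZero_acceptsFrom_zero {D : Type} {s : Unit → Set D} {d : D}
    {w : List (Fin 2 × D)} : (distinctZero D).AcceptsFrom ((), s) ((0, d) :: w) ↔
      d ∉ s () ∧ (distinctZero D).AcceptsFrom ((), fun _ => insert d (s ())) w := by
  have hs : (SafaOp.ins ()).apply d s = fun _ => insert d (s ()) := by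
    funext _; ext x; simp [SafaOp.apply]
  rw [acceptsFrom_cons, ← hs]
  constructor
  · rintro ⟨⟨_, _, k, o, _⟩, ht | ht, -, ha, hc, h⟩
    · obtain ⟨-, rfl, rfl⟩ := ht
      exact ⟨hc, h⟩
    · exact absurd (ht.1.symm.trans ha) (by simp)
  · rintro ⟨hd, h⟩
    exact ⟨⟨(), 0, .neg (), .ins (), ()⟩, Or.inl ⟨rfl, rfl, rfl⟩, rfl, rfl, hd, h⟩

theorem distinctZero_acceptsFrom_one {D : Type} {s : Unit → Set D} {d : D}
    {w : List (Fin 2 × D)} : (distinctZero D).AcceptsFrom ((), s) ((1, d) :: w) ↔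
      (distinctZero D).AcceptsFrom ((), s) w := by
  rw [acceptsFrom_cons]
  constructor
  · rintro ⟨⟨_, _, k, o, _⟩, ht | ht, -, ha, hc, h⟩
    · exact absurd (ht.1.symm.trans ha) (by simp)
    · obtain ⟨-, rfl⟩ := ht
      exact h
  · intro h
    by_cases hd : d ∈ s ()
    · exact ⟨⟨(), 1, .pos (), .noop, ()⟩, Or.inr ⟨rfl, rfl⟩, rfl, rfl, hd, h⟩
    · exact ⟨⟨(), 1, .neg (), .noop, ()⟩, Or.inr ⟨rfl, rfl⟩, rfl, rfl, hd, h⟩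

theorem zeroAfterOne_acceptsFrom_zero {D : Type} {s : Unit → Set D} {d : D}
    {w : List (Fin 2 × D)} : (zeroAfterOne D).AcceptsFrom ((), s) ((0, d) :: w) ↔
      d ∈ s () ∧ (zeroAfterOne D).AcceptsFrom ((), s) w := by
  rw [acceptsFrom_cons]
  constructor
  · rintro ⟨⟨_, _, k, o, _⟩, ht | ht, -, ha, hc, h⟩
    · obtain ⟨-, rfl, rfl⟩ := ht
      exact ⟨hc, h⟩
    · exact absurd (ht.1.symm.trans ha) (by simp)
  · rintro ⟨hd, h⟩
    exact ⟨⟨(), 0, .pos (), .noop, ()⟩, Or.inl ⟨rfl, rfl, rfl⟩, rfl, rfl, hd, h⟩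

theorem zeroAfterOne_acceptsFrom_one {D : Type} {s : Unit → Set D} {d : D}
    {w : List (Fin 2 × D)} : (zeroAfterOne D).AcceptsFrom ((), s) ((1, d) :: w) ↔
      (zeroAfterOne D).AcceptsFrom ((), fun _ => insert d (s ())) w := by
  have hs : (SafaOp.ins ()).apply d s = fun _ => insert d (s ()) := by
    funext _; ext x; simp [SafaOp.apply]
  rw [acceptsFrom_cons, ← hs]
  constructor
  · rintro ⟨⟨_, _, k, o, _⟩, ht | ht, -, ha, hc, h⟩
    · exact absurd (ht.1.symm.trans ha) (by simp)
    · obtain ⟨-, rfl⟩ := ht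
      exact h
  · intro h
    by_cases hd : d ∈ s ()
    · exact ⟨⟨(), 1, .pos (), .ins (), ()⟩, Or.inr ⟨rfl, rfl⟩, rfl, rfl, hd, h⟩
    · exact ⟨⟨(), 1, .neg (), .ins (), ()⟩, Or.inr ⟨rfl, rfl⟩, rfl, rfl, hd, h⟩

theorem distinctZero_acceptsFrom_iff {D : Type} (w : List (Fin 2 × D)) (s : Unit → Set D) :
    (distinctZero D).AcceptsFrom ((), s) w ↔
      w ∈ Lfd D ∧ ∀ d, (0, d) ∈ w → d ∉ s () := by
  induction w generalizing s with
  | nil => simp [acceptsFrom_nil, Lfd, distinctZero]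
  | cons p w ih =>
    obtain ⟨i, d⟩ := p
    obtain rfl | rfl : i = 0 ∨ i = 1 := by omega
    · rw [distinctZero_acceptsFrom_zero, ih]
      simp only [Lfd, Set.mem_ofPred_eq, List.filter_cons, decide_true, if_true, List.map_cons,
        List.nodup_cons, List.mem_map, List.mem_filter, List.mem_cons, Prod.mk.injEq,
        Set.mem_insert_iff, not_or, decide_eq_true_eq, Prod.exists, true_and]
      grind
    · rw [distinctZero_acceptsFrom_one, ih]
      simp [Lfd]

theorem zeroAfterOne_acceptsFrom_iff {D : Type} (w : List (Fin 2 × D)) (s : Unit → Set D) :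
    (zeroAfterOne D).AcceptsFrom ((), s) w ↔ ∀ i : Fin w.length, (w.get i).1 = 0 →
      (w.get i).2 ∈ s () ∨ ∃ j : Fin w.length, (j : ℕ) < (i : ℕ) ∧
        w.get j = (1, (w.get i).2) := by
  induction w generalizing s with
  | nil => simp [acceptsFrom_nil, zeroAfterOne]
  | cons p w ih =>
    obtain ⟨i, d⟩ := p
    obtain rfl | rfl : i = 0 ∨ i = 1 := by omega
    · rw [zeroAfterOne_acceptsFrom_zero, ih]
      simp [Fin.forall_fin_succ, Fin.exists_fin_succ]
    · rw [zeroAfterOne_acceptsFrom_one, ih]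
      simp only [Fin.forall_fin_succ, Fin.exists_fin_succ, List.get_cons_zero, List.get_cons_succ',
        List.length_cons]
      simp [@eq_comm _ d, or_assoc, or_left_comm]

theorem distinctZero_lang (D : Type) : (distinctZero D).Lang = Lfd D := by
  ext w
  exact (distinctZero_acceptsFrom_iff w fun _ => ∅).trans (by simp)

theorem zeroAfterOne_lang (D : Type) : (zeroAfterOne D).Lang = LaExistsB D := by
  ext w
  exact (zeroAfterOne_acceptsFrom_iff w fun _ => ∅).trans (by simp [LaExistsB])

end SAFA

theorem LaExistsB.one_mem {D : Type} {w : List (Fin 2 × D)} (hw : w ∈ LaExistsB D) {d : D}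
    (hd : (0, d) ∈ w) : (1, d) ∈ w := by
  obtain ⟨i, hi⟩ := List.get_of_mem hd
  obtain ⟨j, -, hj⟩ := hw i (by rw [hi])
  rw [hi] at hj
  exact hj ▸ List.get_mem w j

theorem ones_append_zeros_mem {D : Type} {l : List D} (hl : l.Nodup) :
    l.map (Prod.mk (1 : Fin 2)) ++ l.map (Prod.mk (0 : Fin 2)) ∈ Lfd D ∩ LaExistsB D := by
  constructor
  · simpa [Lfd, List.filter_map, Function.comp_def] using hl
  · rintro ⟨i, hi⟩ h0
    simp only [List.length_append, List.length_map] at hi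
    simp only [List.get_eq_getElem] at h0 ⊢
    rcases lt_or_ge i l.length with h | h
    · rw [List.getElem_append_left (by simpa using h)] at h0
      simp at h0
    · refine ⟨⟨i - l.length, by simp; omega⟩, by simp; omega, ?_⟩
      rw [List.getElem_append_left (by simp; omega), List.getElem_append_right (by simpa using h)]
      simp

theorem not_exists_safa_lang_eq_inter {D : Type} [Infinite D] :
    ¬ ∃ M : SAFA (Fin 2) D, M.Lang = Lfd D ∩ LaExistsB D := by
  rintro ⟨M, hM⟩
  let f := Infinite.natEmbedding D
  let n := Fintype.card M.H + 1
  let l := (List.range n).map f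
  have hl : l.Nodup := List.nodup_range.map f.injective
  have hacc : M.AcceptsFrom M.init (l.map (Prod.mk 1) ++ l.map (Prod.mk 0)) := by
    have h := ones_append_zeros_mem hl
    rwa [← hM] at h
  obtain ⟨T, c, hT, hc⟩ := SAFA.acceptsFrom_append.1 hacc
  obtain ⟨e, he⟩ : ∃ e, e ∉ l := by
    classical
    obtain ⟨e, he⟩ := Infinite.exists_notMem_finset l.toFinset
    exact ⟨e, by simpa using he⟩
  have hlang : ∀ v, M.AcceptsFrom c v → l.map (Prod.mk 1) ++ v ∈ Lfd D ∩ LaExistsB D :=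
    fun v hv => hM ▸ SAFA.acceptsFrom_append.2 ⟨T, c, hT, hv⟩
  have hec : ∀ h, e ∉ c.2 h := fun h hm =>
    (hT.mem_iff_of_notMem (by simpa [Function.comp_def] using he) h).1 hm
  have key : ∀ i : Fin n, ∃ h, f i ∈ c.2 h ∧ ∀ j < i, f j ∉ c.2 h := by
    intro i
    obtain ⟨u, v, huv, hu⟩ : ∃ u v, l = u ++ f i :: v ∧ ∀ j < i, f j ∈ u := by
      refine ⟨l.take i, l.drop (i + 1), ?_, fun j hj => ?_⟩
      · have hi : (i : ℕ) < l.length := by simp [l]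
        conv_lhs => rw [← List.take_append_drop i l, List.drop_eq_getElem_cons hi]
        simp [l]
      · rw [List.mem_take_iff_getElem]
        exact ⟨j, by simp [l]; omega, by simp [l]⟩
    rw [huv] at hl he
    simp only [List.mem_append, List.mem_cons, not_or] at he
    have hd := List.nodup_append.1 hl
    have hv := List.nodup_cons.1 hd.2.1
    rw [huv, List.map_append, List.map_cons] at hc
    have hmap : ∀ t : List D, (t.map (Prod.mk (0 : Fin 2))).map Prod.snd = t := fun t => by
      simp [Function.comp_def]
    obtain ⟨h, hih, hrep⟩ := hc.exists_replaceable (e := e)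
      (by rw [hmap]; exact fun h => hd.2.2 _ h _ List.mem_cons_self rfl)
      (by rw [hmap]; exact hv.1) hec (by rw [hmap]; exact he.1) (by rw [hmap]; exact he.2.2)
      (fun hacc => by
        have := LaExistsB.one_mem (hlang _ hacc).2 (d := e) (by simp)
        simp [huv, he] at this)
    refine ⟨h, hih, fun j hj hjh => ?_⟩
    have hbad := (hlang _ (hrep (f j) hjh (by
      rw [hmap]; exact fun h => hd.2.2 _ (hu j hj) _ (List.mem_cons_of_mem _ h) rfl))).1
    simp only [Lfd, Set.mem_ofPred_eq, List.filter_append, List.map_append,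
      List.filter_cons, decide_true, if_true, List.map_cons] at hbad
    have hbad := (List.nodup_append.1 (List.nodup_append.1 hbad).2.1).2.2
    exact hbad (f j) (by simpa using hu j hj) _ List.mem_cons_self rfl
  choose g hg hg' using key
  obtain ⟨i, j, hij, hgij⟩ := Fintype.exists_ne_map_eq_of_card_lt g (by simp [n])
  rcases lt_or_gt_of_ne hij with h | h
  · exact hg' j i h (hgij ▸ hg i)
  · exact hg' i j h (hgij ▸ hg j)

/-- SAFA languages are not closed under intersection:
L_fd(a) and L_a∃b are SAFA languages, but L_fd(a) ∩ L_a∃b is not. -/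
theorem safa_not_closed_intersection {D : Type} [Countable D] [Infinite D] :
    (∃ M : SAFA (Fin 2) D, M.Lang = Lfd D) ∧
    (∃ M : SAFA (Fin 2) D, M.Lang = LaExistsB D) ∧
    ¬ ∃ M : SAFA (Fin 2) D, M.Lang = Lfd D ∩ LaExistsB D :=
  ⟨⟨SAFA.distinctZero D, SAFA.distinctZero_lang D⟩,
    ⟨SAFA.zeroAfterOne D, SAFA.zeroAfterOne_lang D⟩, not_exists_safa_lang_eq_inter⟩
end

section
/- Pumping lemma for SAFA: if L ∈ L_SAFA, then there exists a SAFA M with n states accepting L such that every data word w ∈ L with |w| ≥ n can be written as w = xyz, where the accepting transition sequence of M on w factors as T_w = T_x T_y T_z (T_x, T_y, T_z reading x, y, z respectively), with |y| ≥ 1 and |xy| ≤ n, and for all ℓ ≥ 1, every data word w' = x y y'_1 ⋯ y'_ℓ z' on which M can execute the transition sequence T_x T_y (T_y)^ℓ T_z — i.e., the Σ-projections of y, y'_1, ..., y'_ℓ coincide, the Σ-projections of z and z' coincide, and at each transition of (T_y)^ℓ and T_z with condition p(h_i) (resp. !p(h_i)) the data value read at that position belongs to (resp. does not belong to) the current content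 of h_i — satisfies w' ∈ L. -/
namespace SAFA

variable {A D : Type} {M : SAFA A D}

/-- The state reached from `q` by following the transition sequence `T`. -/
def endState {Q H : Type} (q : Q) (T : List (SafaTrans Q A H)) : Q :=
  T.foldl (fun _ t => t.dst) q

theorem endState_append {Q H : Type} (q : Q) (S T : List (SafaTrans Q A H)) :
    endState q (S ++ T) = endState (endState q S) T :=
  List.foldl_append

theorem endState_flatten_replicate {Q H : Type} {q : Q} {T : List (SafaTrans Q A H)}
    (h : endState q T = q) (n : ℕ) : endState q (List.replicate n T).flatten = q := by
  induction n with
  | zero => rfl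
  | succ n ih => rw [List.replicate_succ, List.flatten_cons, endState_append, h, ih]

theorem ExecFrom.state_eq {c c' : M.Config} {T : List (SafaTrans M.Q A M.H)}
    {w : List (A × D)} (h : M.ExecFrom c T w c') : c'.1 = endState c.1 T := by
  induction h with
  | nil => rfl
  | cons hs _ ih => rw [ih, ← hs.2.2.2.1]; rfl

theorem ExecFrom.exists_take_drop {c c' : M.Config} {T : List (SafaTrans M.Q A M.H)}
    {w : List (A × D)} (h : M.ExecFrom c T w c') (k : ℕ) :
    ∃ d, M.ExecFrom c (T.take k) (w.take k) d ∧ M.ExecFrom d (T.drop k) (w.drop k) c' := by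
  induction h generalizing k with
  | nil c => exact ⟨c, by simpa using .nil c, by simpa using .nil c⟩
  | @cons c _ _ _ _ _ _ hs ht ih =>
    cases k with
    | zero => exact ⟨c, .nil c, .cons hs ht⟩
    | succ k =>
      obtain ⟨d, h₁, h₂⟩ := ih k
      exact ⟨d, .cons hs h₁, h₂⟩

/-- A run of length at least the number of states contains a loop within its first
`Fintype.card M.Q` steps. -/
theorem ExecFrom.exists_loop {c c' : M.Config} {T : List (SafaTrans M.Q A M.H)}
    {w : List (A × D)} (h : M.ExecFrom c T w c') (hw : Fintype.card M.Q ≤ w.length) :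
    ∃ (x y z : List (A × D)) (Tx Ty Tz : List (SafaTrans M.Q A M.H)) (c₁ c₂ : M.Config),
      w = x ++ y ++ z ∧
      M.ExecFrom c Tx x c₁ ∧ M.ExecFrom c₁ Ty y c₂ ∧ M.ExecFrom c₂ Tz z c' ∧
      c₁.1 = c₂.1 ∧ 1 ≤ y.length ∧ x.length + y.length ≤ Fintype.card M.Q := by
  obtain ⟨i, j, hij, hq⟩ : ∃ i j : Fin (Fintype.card M.Q + 1), i < j ∧
      endState c.1 (T.take i) = endState c.1 (T.take j) := by
    obtain ⟨i, j, hne, hq⟩ := Fintype.exists_ne_map_eq_of_card_lt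
      (fun i : Fin (Fintype.card M.Q + 1) => endState c.1 (T.take i)) (by simp)
    rcases lt_or_gt_of_ne hne with hlt | hlt
    · exact ⟨i, j, hlt, hq⟩
    · exact ⟨j, i, hlt, hq.symm⟩
  have hj : (j : ℕ) ≤ Fintype.card M.Q := Nat.le_of_lt_succ j.2
  have hij' : (i : ℕ) < j := hij
  obtain ⟨c₂, hxy, hz⟩ := h.exists_take_drop j
  obtain ⟨c₁, hx, hy⟩ := hxy.exists_take_drop i
  refine ⟨_, _, _, _, _, _, c₁, c₂, ?_, hx, hy, hz, ?_, ?_, ?_⟩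
  · simp only [List.take_append_drop]
  · rw [hx.state_eq, hxy.state_eq, List.take_take, min_eq_left hij'.le, hq]
  · simp only [List.length_drop, List.length_take]; omega
  · simp only [List.length_drop, List.length_take]; omega

end SAFA

/-- pumping lemma for SAFA: if L is a SAFA language, then there is a SAFA M
(with n = |Q| states) accepting L such that every w ∈ L with |w| ≥ n decomposes as
w = x ++ y ++ z, the accepting transition sequence factors as Tx Ty Tz reading x, y, z,
with |y| ≥ 1, |xy| ≤ n, and for all ℓ ≥ 1, every data word x ++ y ++ y'_1⋯y'_ℓ ++ z' on
which M can execute the transition sequence Tx Ty (Ty)^ℓ Tz belongs to L. -/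
theorem safa_pumping {A D : Type} [Fintype A] [Countable D] [Infinite D]
    (L : Set (List (A × D))) (hL : ∃ M : SAFA A D, M.Lang = L) :
    ∃ M : SAFA A D, M.Lang = L ∧
      ∀ w ∈ L, Fintype.card M.Q ≤ w.length →
        ∃ (x y z : List (A × D)) (Tx Ty Tz : List (SafaTrans M.Q A M.H))
          (c1 c2 c3 : M.Config),
          w = x ++ y ++ z ∧
          M.ExecFrom M.init Tx x c1 ∧ M.ExecFrom c1 Ty y c2 ∧ M.ExecFrom c2 Tz z c3 ∧
          c3.1 ∈ M.F ∧
          1 ≤ y.length ∧ x.length + y.length ≤ Fintype.card M.Q ∧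
          ∀ ℓ : ℕ, 1 ≤ ℓ →
            ∀ (ys : List (List (A × D))) (z' : List (A × D)) (cf : M.Config),
              ys.length = ℓ →
              M.ExecFrom M.init (Tx ++ Ty ++ (List.replicate ℓ Ty).flatten ++ Tz)
                (x ++ y ++ ys.flatten ++ z') cf →
              (x ++ y ++ ys.flatten ++ z') ∈ L := by
  obtain ⟨M, rfl⟩ := hL
  refine ⟨M, rfl, ?_⟩
  rintro w ⟨T, c, hT, hF⟩ hw
  obtain ⟨x, y, z, Tx, Ty, Tz, c₁, c₂, hwe, hx, hy, hz, hc, hlen, hle⟩ := hT.exists_loop hw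
  refine ⟨x, y, z, Tx, Ty, Tz, c₁, c₂, c, hwe, hx, hy, hz, hF, hlen, hle, ?_⟩
  intro ℓ _ ys z' cf _ hcf
  refine ⟨_, cf, hcf, ?_⟩
  have hloop : SAFA.endState c₁.1 Ty = c₁.1 := by rw [← hy.state_eq, hc]
  rwa [hcf.state_eq, SAFA.endState_append, SAFA.endState_append, SAFA.endState_append,
    ← hx.state_eq, hloop, SAFA.endState_flatten_replicate hloop, hc, ← hz.state_eq]
end

section
/- The class of data languages accepted by SAFA is not closed under inverse homomorphism. Specifically, over Σ = {a} and D = ℕ, let h be the monoid homomorphism on data words determined by h((a,1)) = ε (the empty word) and h((a,d)) = (a,d) for all d ∈ ℕ with d ≠ 1. The language L_ε = {ε} is accepted by a SAFA, but h⁻¹(L_ε) — the language consisting of ε together with all data words whose every position carries the data value 1 — is not accepted by any SAFA. -/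
namespace SAFA

/-- The SAFA without transitions whose only state is final accepts exactly the empty word. -/
theorem exists_lang_eq_singleton_nil (A D : Type) :
    ∃ M : SAFA A D, M.Lang = {([] : List (A × D))} := by
  refine ⟨⟨Unit, inferInstance, (), Set.univ, Unit, inferInstance, ∅⟩, ?_⟩
  ext w
  constructor
  · rintro ⟨T, c, hexec, -⟩
    cases hexec with
    | nil => rfl
    | cons hstep => exact absurd hstep.1 (Set.notMem_empty _)
  · rintro rfl
    exact ⟨[], _, .nil _, Set.mem_univ _⟩

/-- Acceptance of a one-letter word does not depend on its data value, as all sets are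
initially empty. -/
theorem Accepts.singleton_congr {A D : Type} {M : SAFA A D} {a : A} {d : D}
    (h : M.Accepts [(a, d)]) (e : D) : M.Accepts [(a, e)] := by
  obtain ⟨T, c, hexec, hc⟩ := h
  cases hexec with
  | @cons _ _ _ t _ _ _ hstep hrest =>
    cases hrest
    obtain ⟨ht, hsrc, hattr, hdst, hcond, -⟩ := hstep
    let cfg : M.Config := (c.1, t.op.apply e M.init.2)
    refine ⟨[t], cfg, .cons (c' := cfg) ⟨ht, hsrc, hattr, hdst, ?_, rfl⟩ (.nil cfg), hc⟩
    cases hq : t.cond with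
    | pos q => rw [hq] at hcond; exact absurd hcond (Set.notMem_empty d)
    | neg q => exact Set.notMem_empty e

end SAFA

/-- SAFA languages are not closed under inverse homomorphism: over
Σ = {a}, D = ℕ, with h((a,1)) = ε and h((a,d)) = (a,d) for d ≠ 1, the language {ε} is a
SAFA language, but its preimage h⁻¹({ε}) (ε together with all data words all of whose
positions carry the data value 1) is not. -/
theorem safa_not_closed_inv_hom :
    (∃ M : SAFA Unit ℕ, M.Lang = {([] : List (Unit × ℕ))}) ∧
    ¬ ∃ M : SAFA Unit ℕ, M.Lang =
        (fun w : List (Unit × ℕ) => w.flatMap fun p => if p.2 = 1 then [] else [p]) ⁻¹'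
          {([] : List (Unit × ℕ))} := by
  refine ⟨SAFA.exists_lang_eq_singleton_nil Unit ℕ, ?_⟩
  rintro ⟨M, hM⟩
  have h1 : [((), 1)] ∈ M.Lang := by simp [hM]
  have h2 : [((), 2)] ∈ M.Lang := SAFA.Accepts.singleton_congr h1 2
  simp [hM] at h2
end

section
/- The class of data languages accepted by deterministic SAFA is not closed under concatenation. Specifically, over Σ = {a}: the language L1 = L_fd(a) of data words whose data values are pairwise distinct and the language L2 = { (a,d)(a,d) : d ∈ D } are each accepted by a DSAFA, but no DSAFA accepts the concatenation L1·L2. -/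
/-- L1 = L_fd(a) over the one-letter alphabet: data values pairwise distinct. -/
def LfdUnit (D : Type) : Set (List (Unit × D)) :=
  {w | (w.map Prod.snd).Nodup}

/-- L2 = { (a,d)(a,d) : d ∈ D } over the one-letter alphabet. -/
def pairLang (D : Type) : Set (List (Unit × D)) :=
  {w | ∃ d : D, w = [((), d), ((), d)]}

namespace SAFA

variable {A D : Type}

/-- Some run of `M` reading `w` leads from `c` to `c'`. -/
def Reach (M : SAFA A D) (c : M.Config) (w : List (A × D)) (c' : M.Config) : Prop :=
  ∃ T, M.ExecFrom c T w c'

theorem mem_lang_iff {M : SAFA A D} {w : List (A × D)} :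
    w ∈ M.Lang ↔ ∃ c, M.Reach M.init w c ∧ c.1 ∈ M.F :=
  ⟨fun ⟨T, c, h, hF⟩ => ⟨c, ⟨T, h⟩, hF⟩, fun ⟨c, ⟨T, h⟩, hF⟩ => ⟨T, c, h, hF⟩⟩

theorem reach_nil {M : SAFA A D} {c c' : M.Config} : M.Reach c [] c' ↔ c = c' := by
  constructor
  · rintro ⟨T, h⟩
    cases h
    rfl
  · rintro rfl
    exact ⟨[], .nil c⟩

theorem reach_cons {M : SAFA A D} {c c' : M.Config} {a : A × D} {w : List (A × D)} :
    M.Reach c (a :: w) c' ↔ ∃ t c₁, M.StepVia c t a c₁ ∧ M.Reach c₁ w c' := by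
  constructor
  · rintro ⟨T, h⟩
    cases h with
    | cons hs he => exact ⟨_, _, hs, _, he⟩
  · rintro ⟨t, c₁, hs, T, he⟩
    exact ⟨t :: T, .cons hs he⟩

theorem reach_append {M : SAFA A D} {c c' : M.Config} {u v : List (A × D)} :
    M.Reach c (u ++ v) c' ↔ ∃ c₁, M.Reach c u c₁ ∧ M.Reach c₁ v c' := by
  induction u generalizing c with
  | nil => simp [reach_nil]
  | cons a u ih =>
    simp only [List.cons_append, reach_cons, ih]
    constructor
    · rintro ⟨t, c₁, hs, c₂, hu, hv⟩
      exact ⟨c₂, ⟨t, c₁, hs, hu⟩, hv⟩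
    · rintro ⟨c₂, ⟨t, c₁, hs, hu⟩, hv⟩
      exact ⟨t, c₁, hs, c₂, hu, hv⟩

theorem IsDeterministic.stepVia_unique {M : SAFA A D} (hM : M.IsDeterministic)
    {c c₁ c₂ : M.Config} {t₁ t₂ : SafaTrans M.Q A M.H} {a : A × D}
    (h₁ : M.StepVia c t₁ a c₁) (h₂ : M.StepVia c t₂ a c₂) : c₁ = c₂ := by
  obtain ⟨m₁, s₁, a₁, d₁, k₁, o₁⟩ := h₁
  obtain ⟨m₂, s₂, a₂, d₂, k₂, o₂⟩ := h₂
  obtain ⟨hn, he⟩ := hM t₁ t₂ m₁ m₂ (s₁.trans s₂.symm) (a₁.trans a₂.symm)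
  have hc : t₁.cond = t₂.cond := by
    cases e₁ : t₁.cond <;> cases e₂ : t₂.cond <;>
      simp_all [SafaCond.name, SafaCond.holds]
  obtain rfl := he hc
  exact Prod.ext (d₁.symm.trans d₂) (o₁.trans o₂.symm)

theorem IsDeterministic.reach_unique {M : SAFA A D} (hM : M.IsDeterministic)
    {c c₁ c₂ : M.Config} {w : List (A × D)}
    (h₁ : M.Reach c w c₁) (h₂ : M.Reach c w c₂) : c₁ = c₂ := by
  induction w generalizing c with
  | nil => exact (reach_nil.1 h₁).symm.trans (reach_nil.1 h₂)
  | cons a w ih =>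
    obtain ⟨t, b, hs, hr⟩ := reach_cons.1 h₁
    obtain ⟨t', b', hs', hr'⟩ := reach_cons.1 h₂
    obtain rfl := hM.stepVia_unique hs hs'
    exact ih hr hr'

theorem StepVia.subset {M : SAFA A D} {c c' : M.Config} {t : SafaTrans M.Q A M.H} {a : A × D}
    (hs : M.StepVia c t a c') (h : M.H) : c.2 h ⊆ c'.2 h := by
  obtain ⟨-, -, -, -, -, ho⟩ := hs
  rw [ho]
  cases t.op with
  | noop => exact subset_rfl
  | ins j => exact Set.subset_union_left

theorem StepVia.mem_or_eq {M : SAFA A D} {c c' : M.Config} {t : SafaTrans M.Q A M.H} {a : A × D}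
    (hs : M.StepVia c t a c') {h : M.H} {x : D} (hx : x ∈ c'.2 h) : x ∈ c.2 h ∨ x = a.2 := by
  obtain ⟨-, -, -, -, -, ho⟩ := hs
  rw [ho] at hx
  cases e : t.op with
  | noop => exact .inl (by simpa [e, SafaOp.apply] using hx)
  | ins j => exact Or.imp_right And.right (by simpa [e, SafaOp.apply] using hx)

theorem Reach.subset {M : SAFA A D} {c c' : M.Config} {w : List (A × D)}
    (hr : M.Reach c w c') (h : M.H) : c.2 h ⊆ c'.2 h := by
  induction w generalizing c with
  | nil => rw [reach_nil.1 hr]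
  | cons a w ih =>
    obtain ⟨t, b, hs, hr⟩ := reach_cons.1 hr
    exact (hs.subset h).trans (ih hr)

theorem Reach.mem_or_mem {M : SAFA A D} {c c' : M.Config} {w : List (A × D)}
    (hr : M.Reach c w c') {h : M.H} {x : D} (hx : x ∈ c'.2 h) :
    x ∈ c.2 h ∨ x ∈ w.map Prod.snd := by
  induction w generalizing c with
  | nil => exact .inl (by rwa [reach_nil.1 hr])
  | cons a w ih =>
    obtain ⟨t, b, hs, hr⟩ := reach_cons.1 hr
    rcases ih hr with hb | hw
    · rcases hs.mem_or_eq hb with hc | rfl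
      · exact .inl hc
      · exact .inr (by simp)
    · exact .inr (List.mem_cons_of_mem _ hw)

end SAFA

/-- Two transitions testing the same set under distinct conditions, the second of which fires on a
value outside that set: the first one tests membership and the second one non-membership. -/
theorem SafaCond.eq_pos_and_eq_neg {H D : Type} {k k' : SafaCond H} {s : H → Set D} {x : D}
    (hn : k.name = k'.name) (hne : k ≠ k') (hk : k'.holds x s) (hx : ∀ h, x ∉ s h) :
    k = .pos k.name ∧ k' = .neg k.name := by
  cases k <;> cases k' <;> simp_all [SafaCond.name, SafaCond.holds]

/-- The one-state automaton accepting the words with pairwise distinct data values. -/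
def fdSafa (D : Type) : SAFA Unit D where
  Q := Unit
  fintypeQ := inferInstance
  q0 := ()
  F := Set.univ
  H := Unit
  fintypeH := inferInstance
  δ := {⟨(), (), .neg (), .ins (), ()⟩}

theorem fdSafa_reach_iff {D : Type} (c : (fdSafa D).Config) (w : List (Unit × D)) :
    (∃ c', (fdSafa D).Reach c w c') ↔
      (w.map Prod.snd).Nodup ∧ ∀ d ∈ w.map Prod.snd, d ∉ c.2 () := by
  induction w generalizing c with
  | nil => simp [SAFA.reach_nil]
  | cons a w ih =>
    have key : (∃ c', (fdSafa D).Reach c (a :: w) c') ↔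
        a.2 ∉ c.2 () ∧ ∃ c', (fdSafa D).Reach ((), fun j => c.2 j ∪ {x | j = () ∧ x = a.2}) w c' := by
      constructor
      · rintro ⟨c', h⟩
        obtain ⟨t, b, ⟨ht, -, -, -, hk, ho⟩, hr⟩ := SAFA.reach_cons.1 h
        obtain rfl : t = ⟨(), (), .neg (), .ins (), ()⟩ := ht
        exact ⟨hk, c', by rw [show b = (b.1, b.2) from rfl, ho] at hr; exact hr⟩
      · rintro ⟨hk, c', hr⟩
        exact ⟨c', SAFA.reach_cons.2
          ⟨⟨(), (), .neg (), .ins (), ()⟩, _, ⟨rfl, rfl, rfl, rfl, hk, rfl⟩, hr⟩⟩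
    rw [key, ih]
    simp only [List.map_cons, List.nodup_cons, List.mem_cons, forall_eq_or_imp, Set.mem_union,
      Set.mem_ofPred_eq, not_or]
    constructor
    · rintro ⟨h₁, h₂, h₃⟩
      exact ⟨⟨fun h => (h₃ _ h).2 ⟨rfl, rfl⟩, h₂⟩, h₁, fun d hd => (h₃ d hd).1⟩
    · rintro ⟨⟨h₁, h₂⟩, h₃, h₄⟩
      exact ⟨h₃, h₂, fun d hd => ⟨h₄ d hd, fun e => h₁ (e.2 ▸ hd)⟩⟩

theorem fdSafa_isDeterministic (D : Type) : (fdSafa D).IsDeterministic := by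
  rintro t₁ t₂ rfl rfl - -
  exact ⟨rfl, fun _ => rfl⟩

theorem fdSafa_lang (D : Type) : (fdSafa D).Lang = LfdUnit D := by
  ext w
  rw [SAFA.mem_lang_iff]
  have h := fdSafa_reach_iff (fdSafa D).init w
  simp only [SAFA.init, Set.mem_empty_iff_false, not_false_eq_true, implies_true, and_true] at h
  exact Iff.trans ⟨fun ⟨c, hc, _⟩ => ⟨c, hc⟩, fun ⟨c, hc⟩ => ⟨c, hc, trivial⟩⟩ h

/-- The three-state automaton that stores its first value and then reads it again. -/
def pairSafa (D : Type) : SAFA Unit D where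
  Q := Fin 3
  fintypeQ := inferInstance
  q0 := 0
  F := {2}
  H := Unit
  fintypeH := inferInstance
  δ := {⟨0, (), .neg (), .ins (), 1⟩, ⟨1, (), .pos (), .noop, 2⟩}

theorem pairSafa_isDeterministic (D : Type) : (pairSafa D).IsDeterministic := by
  rintro t₁ t₂ (rfl | rfl) (rfl | rfl) hs -
  · exact ⟨rfl, fun _ => rfl⟩
  · exact absurd hs (by decide : (0 : Fin 3) ≠ 1)
  · exact absurd hs (by decide : (1 : Fin 3) ≠ 0)
  · exact ⟨rfl, fun _ => rfl⟩

theorem pairSafa_lang (D : Type) : (pairSafa D).Lang = pairLang D := by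
  have h01 : (0 : Fin 3) ≠ 1 := by decide
  have h02 : (0 : Fin 3) ≠ 2 := by decide
  have h12 : (1 : Fin 3) ≠ 2 := by decide
  ext w
  rw [SAFA.mem_lang_iff]
  constructor
  · rintro ⟨c, hr, hF⟩
    replace hF : c.1 = (2 : Fin 3) := hF
    match w with
    | [] =>
      obtain rfl := SAFA.reach_nil.1 hr
      exact absurd hF h02
    | [a] =>
      obtain ⟨t, b, ⟨ht, hs, -, hd, -, -⟩, hr⟩ := SAFA.reach_cons.1 hr
      obtain rfl := SAFA.reach_nil.1 hr
      rcases ht with rfl | rfl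
      · exact absurd (hd.trans hF) h12
      · exact absurd hs h01.symm
    | a :: a' :: w =>
      obtain ⟨t, b, ⟨ht, hs, -, hd, -, ho⟩, hr⟩ := SAFA.reach_cons.1 hr
      obtain ⟨t', b', ⟨ht', hs', -, hd', hk', -⟩, hr⟩ := SAFA.reach_cons.1 hr
      rcases ht with rfl | rfl
      swap
      · exact absurd hs h01.symm
      rcases ht' with rfl | rfl
      · exact absurd (hs'.trans hd.symm) h01
      cases w with
      | nil =>
        have hk : a'.2 ∈ b.2 () := hk'
        rw [ho] at hk
        have hk : a'.2 ∈ (∅ : Set D) ∨ () = () ∧ a'.2 = a.2 := hk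
        have hk : a'.2 = a.2 := hk.elim (fun h => h.elim) And.right
        exact ⟨a.2, by rw [show a' = a from Prod.ext rfl hk]⟩
      | cons a'' w =>
        obtain ⟨t'', b'', ⟨ht'', hs'', -⟩, -⟩ := SAFA.reach_cons.1 hr
        rcases ht'' with rfl | rfl
        · exact absurd (hs''.trans hd'.symm) h02
        · exact absurd (hs''.trans hd'.symm) h12
  · rintro ⟨d, rfl⟩
    refine ⟨((2 : Fin 3), fun j => ∅ ∪ {x | j = () ∧ x = d}), ?_, rfl⟩
    refine SAFA.reach_cons.2 ⟨⟨(0 : Fin 3), (), .neg (), .ins (), (1 : Fin 3)⟩,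
      ((1 : Fin 3), fun j => ∅ ∪ {x | j = () ∧ x = d}),
      ⟨.inl rfl, rfl, rfl, rfl, Set.notMem_empty d, rfl⟩, ?_⟩
    exact SAFA.reach_cons.2 ⟨⟨(1 : Fin 3), (), .pos (), .noop, (2 : Fin 3)⟩,
      ((2 : Fin 3), fun j => ∅ ∪ {x | j = () ∧ x = d}),
      ⟨.inr rfl, rfl, rfl, rfl, .inr ⟨rfl, rfl⟩, rfl⟩, SAFA.reach_nil.2 rfl⟩

/-- The concatenation of `LfdUnit D` and `pairLang D`. -/
def fdPairLang (D : Type) : Set (List (Unit × D)) :=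
  {w | ∃ u ∈ LfdUnit D, ∃ v ∈ pairLang D, w = u ++ v}

/-- The word listing the values `f 0, …, f (n - 1)`. -/
def initialWord {D : Type} (f : ℕ → D) (n : ℕ) : List (Unit × D) :=
  (List.range n).map fun i => ((), f i)

theorem initialWord_succ {D : Type} (f : ℕ → D) (n : ℕ) :
    initialWord f (n + 1) = initialWord f n ++ [((), f n)] := by
  simp [initialWord, List.range_succ]

theorem initialWord_mem_lfdUnit {D : Type} {f : ℕ → D} (hf : f.Injective) (n : ℕ) :
    initialWord f n ∈ LfdUnit D := by
  have : (initialWord f n).map Prod.snd = (List.range n).map f := by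
    simp [initialWord]
  change ((initialWord f n).map Prod.snd).Nodup
  rw [this]
  exact List.nodup_range.map hf

theorem notMem_fdPairLang {D : Type} {w : List (Unit × D)} {x y : D} (h : x ≠ y) :
    w ++ [((), x)] ++ [((), y)] ∉ fdPairLang D := by
  rintro ⟨u, -, v, ⟨d, rfl⟩, he⟩
  have he : (w ++ [((), x)]) ++ [((), y)] = (u ++ [((), d)]) ++ [((), d)] := by
    simpa using he
  obtain ⟨h₁, h₂⟩ := List.append_inj' he rfl
  obtain ⟨-, h₃⟩ := List.append_inj' h₁ rfl
  simp only [List.cons.injEq, Prod.mk.injEq, true_and, and_true] at h₂ h₃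
  exact h (h₃.trans h₂.symm)

namespace SAFA

variable {D : Type}

/-- After pairwise distinct values, the automaton must test a set holding, among the values read,
only the last one. -/
theorem exists_reach_separating {M : SAFA Unit D} (hM : M.IsDeterministic)
    (hL : M.Lang = fdPairLang D) {f : ℕ → D} (hf : f.Injective) (n : ℕ) :
    ∃ c h, M.Reach M.init (initialWord f (n + 1)) c ∧ f n ∈ c.2 h ∧ ∀ m < n, f m ∉ c.2 h := by
  obtain ⟨c', hr', hF⟩ : ∃ c, M.Reach M.init (initialWord f (n + 1) ++ [((), f n)]) c ∧
      c.1 ∈ M.F := by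
    rw [← mem_lang_iff, hL]
    exact ⟨_, initialWord_mem_lfdUnit hf n, _, ⟨f n, rfl⟩, by simp [initialWord_succ]⟩
  obtain ⟨c, hc, hr'⟩ := reach_append.1 hr'
  obtain ⟨t, _, ⟨ht, hs, -, hd, hk, -⟩, hr'⟩ := reach_cons.1 hr'
  obtain rfl := reach_nil.1 hr'
  have other : ∀ y, f n ≠ y → ∃ t', t' ∈ M.δ ∧ t'.src = c.1 ∧ t'.cond.holds y c.2 ∧
      t'.dst ∉ M.F := by
    intro y hy
    obtain ⟨e, hr, -⟩ : ∃ e, M.Reach M.init (initialWord f (n + 1) ++ [((), y), ((), y)]) e ∧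
        e.1 ∈ M.F := by
      rw [← mem_lang_iff, hL]
      exact ⟨_, initialWord_mem_lfdUnit hf (n + 1), _, ⟨y, rfl⟩, rfl⟩
    obtain ⟨c₁, hc₁, hr⟩ := reach_append.1 hr
    obtain rfl := hM.reach_unique hc hc₁
    obtain ⟨t', e', hst, -⟩ := reach_cons.1 hr
    refine ⟨t', hst.1, hst.2.1, hst.2.2.2.2.1, fun hF' => ?_⟩
    rw [hst.2.2.2.1] at hF'
    refine notMem_fdPairLang (w := initialWord f n) hy ?_
    rw [← initialWord_succ, ← hL, mem_lang_iff]
    exact ⟨e', reach_append.2 ⟨c, hc, reach_cons.2 ⟨t', e', hst, reach_nil.2 rfl⟩⟩, hF'⟩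
  have separated : ∀ t', t' ∈ M.δ → t'.src = c.1 → t'.dst ∉ M.F →
      t.cond.name = t'.cond.name ∧ t.cond ≠ t'.cond := by
    intro t' ht' hs' hF'
    obtain ⟨hn, he⟩ := hM t t' ht ht' (hs.trans hs'.symm) rfl
    exact ⟨hn, fun hc => hF' (by rw [← he hc, hd]; exact hF)⟩
  have fresh : ∀ h, f (n + 1) ∉ c.2 h := by
    intro h hx
    rcases hc.mem_or_mem hx with h | h
    · exact h
    · simp [initialWord, hf.eq_iff] at h
  obtain ⟨t₁, ht₁, hs₁, hk₁, hF₁⟩ := other (f (n + 1)) fun h => by simpa using hf h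
  obtain ⟨hn₁, hne₁⟩ := separated t₁ ht₁ hs₁ hF₁
  obtain ⟨hpos, -⟩ := SafaCond.eq_pos_and_eq_neg hn₁ hne₁ hk₁ fresh
  refine ⟨c, t.cond.name, hc, ?_, fun m hm hx => ?_⟩
  · rw [hpos] at hk
    exact hk
  · obtain ⟨t₂, ht₂, hs₂, hk₂, hF₂⟩ := other (f m) fun h => hm.ne' (hf h)
    obtain ⟨hn₂, hne₂⟩ := separated t₂ ht₂ hs₂ hF₂
    cases e : t₂.cond with
    | pos h => exact hne₂ (by rw [hpos, hn₂, e]; rfl)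
    | neg h =>
      rw [e] at hk₂ hn₂
      rw [hn₂] at hx
      exact hk₂ hx

theorem IsDeterministic.lang_ne_fdPairLang [Infinite D] {M : SAFA Unit D}
    (hM : M.IsDeterministic) : M.Lang ≠ fdPairLang D := by
  intro hL
  let f := Infinite.natEmbedding D
  choose c h hr hmem hnot using exists_reach_separating hM hL f.injective
  have hne : ∀ m n, m < n → h m ≠ h n := by
    intro m n hmn he
    have hw : initialWord f (m + 1) <+: initialWord f (n + 1) :=
      List.IsPrefix.map _ (by
        obtain ⟨k, rfl⟩ := Nat.exists_eq_add_of_lt hmn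
        rw [show m + k + 1 + 1 = (m + 1) + (k + 1) by omega, List.range_add (n := m + 1)]
        exact List.prefix_append _ _)
    obtain ⟨v, hv⟩ := hw
    have hr' := hr n
    rw [← hv] at hr'
    obtain ⟨c₁, hc₁, hr'⟩ := reach_append.1 hr'
    obtain rfl := hM.reach_unique (hr m) hc₁
    exact hnot n m hmn (he ▸ hr'.subset (h m) (hmem m))
  refine not_injective_infinite_finite h fun m n he => ?_
  rcases lt_trichotomy m n with hlt | heq | hlt
  · exact absurd he (hne m n hlt)
  · exact heq
  · exact absurd he.symm (hne n m hlt)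

end SAFA

/-- deterministic SAFA languages are not closed under concatenation:
L1 = L_fd(a) and L2 = {(a,d)(a,d)} are DSAFA languages, but L1·L2 is not. -/
theorem dsafa_not_closed_concat {D : Type} [Countable D] [Infinite D] :
    (∃ M : SAFA Unit D, M.IsDeterministic ∧ M.Lang = LfdUnit D) ∧
    (∃ M : SAFA Unit D, M.IsDeterministic ∧ M.Lang = pairLang D) ∧
    ¬ ∃ M : SAFA Unit D, M.IsDeterministic ∧
        M.Lang = {w | ∃ u ∈ LfdUnit D, ∃ v ∈ pairLang D, w = u ++ v} :=
  ⟨⟨fdSafa D, fdSafa_isDeterministic D, fdSafa_lang D⟩,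
    ⟨pairSafa D, pairSafa_isDeterministic D, pairSafa_lang D⟩,
    fun ⟨_, hM, hL⟩ => hM.lang_ne_fdPairLang hL⟩
end
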